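/- arXiv:1211.4103 — 2 statements merged into one kernel-verified Lean document; each statement's English description precedes it below -/
import Mathlib

section
/- Let C > 0, r > 0 and a < b be real numbers with b − a ≤ r²/(2C). Let R : [a,b] → ℝ be differentiable with R(a) ≤ 0, and suppose that |R′(t)| ≤ C·R(t)² for every t ∈ [a,b] at which R(t) ≥ r^{−2}. Then R(t) ≤ 2r^{−2} for all t ∈ [a,b]. -/
/-- Comparison with the solution `t ↦ (D - c (t - a))⁻¹` of the Riccati equation `y' = c y²`: a
function that starts below it and satisfies `f' < c f²` wherever `f ≥ D⁻¹` stays below it. -/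
theorem le_inv_sub_of_deriv_lt_mul_sq {c D a b : ℝ} (hc : 0 ≤ c) (hlen : c * (b - a) < D)
    {f f' : ℝ → ℝ} (hf : ∀ t ∈ Set.Icc a b, HasDerivWithinAt f (f' t) (Set.Icc a b) t)
    (hinit : f a ≤ D⁻¹)
    (hderiv : ∀ t ∈ Set.Icc a b, D⁻¹ ≤ f t → f' t < c * f t ^ 2) :
    ∀ t ∈ Set.Icc a b, f t ≤ (D - c * (t - a))⁻¹ := by
  have hpos : ∀ t ∈ Set.Icc a b, 0 < D - c * (t - a) := fun t ht => by
    have : c * (t - a) ≤ c * (b - a) := by gcongr; exact ht.2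
    linarith
  have hB : ∀ t ∈ Set.Icc a b,
      HasDerivAt (fun x => (D - c * (x - a))⁻¹) (c * ((D - c * (t - a))⁻¹) ^ 2) t := fun t ht => by
    have h := ((((hasDerivAt_id t).sub_const a).const_mul c).const_sub D).fun_inv (hpos t ht).ne'
    exact h.congr_deriv (by simp [div_eq_mul_inv])
  intro x hx
  refine image_le_of_deriv_right_lt_deriv_boundary' (f' := f')
    (fun t ht => (hf t ht).continuousWithinAt)
    (fun t ht => ?_) (by simpa using hinit)
    (fun t ht => (hB t ht).continuousAt.continuousWithinAt)
    (fun t ht => (hB t (Set.Ico_subset_Icc_self ht)).hasDerivWithinAt) (fun t ht heq => ?_) hx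
  · exact (hf t (Set.Ico_subset_Icc_self ht)).mono_of_mem_nhdsWithin
      (Icc_mem_nhdsGE_of_mem ht)
  · have ht' := Set.Ico_subset_Icc_self ht
    rw [← heq]
    refine hderiv t ht' (heq ▸ inv_anti₀ (hpos t ht') ?_)
    have := mul_nonneg hc (sub_nonneg.2 ht.1)
    linarith

/-- Let `C > 0`, `r > 0` and `a < b` be real numbers with `b − a ≤ r²/(2C)`.
Let `R : [a,b] → ℝ` be differentiable with `R a ≤ 0`, and suppose that `|R′ t| ≤ C·(R t)²` for
every `t ∈ [a,b]` at which `R t ≥ r⁻²`. Then `R t ≤ 2 r⁻²` for all `t ∈ [a,b]`. -/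
theorem scalar_curvature_bound_on_short_interval
    (C r a b : ℝ) (hC : 0 < C) (hr : 0 < r) (hab : a < b) (hlen : b - a ≤ r ^ 2 / (2 * C))
    (R R' : ℝ → ℝ)
    (hR : ∀ t ∈ Set.Icc a b, HasDerivAt R (R' t) t)
    (hinit : R a ≤ 0)
    (hderiv : ∀ t ∈ Set.Icc a b, (r ^ 2)⁻¹ ≤ R t → |R' t| ≤ C * (R t) ^ 2) :
    ∀ t ∈ Set.Icc a b, R t ≤ 2 * (r ^ 2)⁻¹ := by
  intro t ht
  have hr2 : 0 < r ^ 2 := by positivity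
  have hCt : 2 * C * (t - a) ≤ r ^ 2 := by
    have h := (le_div_iff₀ (by positivity)).1 hlen
    nlinarith [ht.2]
  have key : ∀ c ∈ Set.Ioo C (2 * C), R t ≤ (r ^ 2 - c * (t - a))⁻¹ := fun c hc => by
    have hsub : Set.Icc a t ⊆ Set.Icc a b := Set.Icc_subset_Icc_right ht.2
    refine le_inv_sub_of_deriv_lt_mul_sq (hC.trans hc.1).le ?_
      (fun s hs => (hR s (hsub hs)).hasDerivWithinAt) (hinit.trans (by positivity))
      (fun s hs hs' => ?_) t ⟨ht.1, le_rfl⟩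
    · rcases ht.1.eq_or_lt with rfl | hat
      · simpa using hr2
      · nlinarith [mul_lt_mul_of_pos_right hc.2 (sub_pos.2 hat)]
    · have hRs : 0 < R s := (inv_pos.2 hr2).trans_le hs'
      exact ((le_abs_self _).trans (hderiv s (hsub hs) hs')).trans_lt
        (mul_lt_mul_of_pos_right hc.1 (by positivity))
  have hpos : 0 < r ^ 2 - C * (t - a) := by linarith
  have hlim : Filter.Tendsto (fun c => (r ^ 2 - c * (t - a))⁻¹) (nhdsWithin C (Set.Ioi C))
      (nhds (r ^ 2 - C * (t - a))⁻¹) := by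
    have h : ContinuousAt (fun c => (r ^ 2 - c * (t - a))⁻¹) C :=
      ContinuousAt.inv₀ (by fun_prop) hpos.ne'
    exact h.mono_left nhdsWithin_le_nhds
  have hle : R t ≤ (r ^ 2 - C * (t - a))⁻¹ :=
    ge_of_tendsto hlim (Filter.eventually_of_mem (Ioo_mem_nhdsGT (by linarith)) key)
  calc R t ≤ (r ^ 2 - C * (t - a))⁻¹ := hle
    _ ≤ (r ^ 2 / 2)⁻¹ := inv_anti₀ (by positivity) (by linarith)
    _ = 2 * (r ^ 2)⁻¹ := by rw [inv_div, div_eq_mul_inv]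
end

section
/- Let T ≥ 1 and C > 0. Let y : [T,∞) → [0,∞) be differentiable; let L : [T,∞) → (0,∞) satisfy L(t) → 0 as t → ∞ and L(t) ≤ 2·L(a) whenever T ≤ a ≤ t; and let b : [T,∞) → ℝ be continuously differentiable, nondecreasing, with b(t) → ∞ as t → ∞. If y′(t) ≤ −y(t)/(4t) + C·(L(t)/t + e^{−b(t)}·b′(t)) for all t ≥ T, then y(t) → 0 as t → ∞. -/
open Filter Topology

/-- If `f' ≤ -k f / t` on `[a, ∞)` with `0 < a`, then `t ^ k * f t` is nonincreasing there. -/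
theorem antitoneOn_rpow_mul_of_deriv_le {a k : ℝ} (ha : 0 < a) {f f' : ℝ → ℝ}
    (hf : ∀ t, a ≤ t → HasDerivAt f (f' t) t)
    (hle : ∀ t, a ≤ t → f' t ≤ -(k * f t / t)) :
    AntitoneOn (fun t => t ^ k * f t) (Set.Ici a) := by
  have hderiv : ∀ t, a ≤ t →
      HasDerivAt (fun t => t ^ k * f t) (k * t ^ (k - 1) * f t + t ^ k * f' t) t := fun t ht =>
    (Real.hasDerivAt_rpow_const (Or.inl (ha.trans_le ht).ne')).mul (hf t ht)
  refine antitoneOn_of_hasDerivWithinAt_nonpos (convex_Ici a)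
    (fun t ht => (hderiv t ht).continuousAt.continuousWithinAt)
    (fun t ht => (hderiv t (interior_subset ht)).hasDerivWithinAt) fun t ht => ?_
  have hat : a ≤ t := interior_subset ht
  have ht0 : 0 < t := ha.trans_le hat
  calc k * t ^ (k - 1) * f t + t ^ k * f' t
      = t ^ k * (k * f t / t + f' t) := by
        rw [Real.rpow_sub_one ht0.ne']
        ring
    _ ≤ 0 := mul_nonpos_of_nonneg_of_nonpos (Real.rpow_nonneg ht0.le k)
        (by linarith [hle t hat])

/-- If `f' ≤ -k f / t` on `[a, ∞)` with `0 < a` and `0 < k`, then `f` is eventually below every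
positive number. -/
theorem eventually_lt_of_deriv_le {a k : ℝ} (ha : 0 < a) (hk : 0 < k) {f f' : ℝ → ℝ}
    (hf : ∀ t, a ≤ t → HasDerivAt f (f' t) t)
    (hle : ∀ t, a ≤ t → f' t ≤ -(k * f t / t)) {ε : ℝ} (hε : 0 < ε) :
    ∀ᶠ t in atTop, f t < ε := by
  have hanti := antitoneOn_rpow_mul_of_deriv_le ha hf hle
  filter_upwards [((tendsto_rpow_atTop hk).atTop_mul_const hε).eventually_gt_atTop (a ^ k * f a),
    eventually_ge_atTop a] with t hgt hat
  have hdecr : t ^ k * f t ≤ a ^ k * f a := hanti Set.self_mem_Ici hat hat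
  exact lt_of_mul_lt_mul_left (hdecr.trans_lt hgt) (Real.rpow_nonneg (ha.le.trans hat) k)

/-- Let `T ≥ 1` and `C > 0`. Let `y : [T,∞) → [0,∞)` be differentiable; let
`L : [T,∞) → (0,∞)` satisfy `L t → 0` as `t → ∞` and `L t ≤ 2·L a` whenever `T ≤ a ≤ t`; and
let `b : [T,∞) → ℝ` be continuously differentiable, nondecreasing, with `b t → ∞` as `t → ∞`.
If `y′ t ≤ −y t/(4t) + C·(L t/t + e^(−b t)·b′ t)` for all `t ≥ T`, then `y t → 0` as `t → ∞`. -/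
theorem normalised_area_tends_to_zero
    (T C : ℝ) (hT : 1 ≤ T) (hC : 0 < C)
    (y y' L b b' : ℝ → ℝ)
    (hy : ∀ t, T ≤ t → HasDerivAt y (y' t) t)
    (hynn : ∀ t, T ≤ t → 0 ≤ y t)
    (hLpos : ∀ t, T ≤ t → 0 < L t)
    (hLtend : Filter.Tendsto L Filter.atTop (𝓝 0))
    (hLalm : ∀ a t, T ≤ a → a ≤ t → L t ≤ 2 * L a)
    (hb : ∀ t, T ≤ t → HasDerivAt b (b' t) t)
    (hb' : ContinuousOn b' (Set.Ici T))
    (hbmono : MonotoneOn b (Set.Ici T))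
    (hbtend : Filter.Tendsto b Filter.atTop Filter.atTop)
    (hineq : ∀ t, T ≤ t →
      y' t ≤ -(y t) / (4 * t) + C * (L t / t + Real.exp (-(b t)) * b' t)) :
    Filter.Tendsto y Filter.atTop (𝓝 0) := by
  have hexp : Tendsto (fun t => Real.exp (-(b t))) atTop (𝓝 0) :=
    Real.tendsto_exp_neg_atTop_nhds_zero.comp hbtend
  refine tendsto_order.2 ⟨fun ε hε => ?_, fun ε hε => ?_⟩
  · filter_upwards [eventually_ge_atTop T] with t ht using hε.trans_le (hynn t ht)
  obtain ⟨δ, hδ, hδε⟩ : ∃ δ : ℝ, 0 < δ ∧ 5 * C * δ = ε / 2 :=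
    ⟨ε / (10 * C), by positivity, by field_simp; norm_num⟩
  obtain ⟨a, hsmall⟩ := eventually_atTop.1 ((hLtend.eventually_le_const hδ).and
    ((hexp.eventually_le_const hδ).and (eventually_ge_atTop T)))
  have haT : T ≤ a := (hsmall a le_rfl).2.2
  have hderiv : ∀ t, a ≤ t → HasDerivAt (fun t => y t + C * Real.exp (-(b t)) - 5 * C * δ)
      (y' t + C * (Real.exp (-(b t)) * -b' t)) t := fun t ht =>
    ((hy t (haT.trans ht)).add ((hb t (haT.trans ht)).neg.exp.const_mul C)).sub_const _
  have hbound : ∀ t, a ≤ t → y' t + C * (Real.exp (-(b t)) * -b' t) ≤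
      -(1 / 4 * (y t + C * Real.exp (-(b t)) - 5 * C * δ) / t) := by
    intro t ht
    obtain ⟨hL, hE, htT⟩ := hsmall t ht
    have ht0 : 0 < t := by linarith
    have hrest : 0 ≤ C * ((δ - L t) + (δ - Real.exp (-(b t))) / 4) / t := by
      have := sub_nonneg.2 hL
      have := sub_nonneg.2 hE
      positivity
    have hsplit : -(1 / 4 * (y t + C * Real.exp (-(b t)) - 5 * C * δ) / t) =
        -(y t) / (4 * t) + C * (L t / t) +
          C * ((δ - L t) + (δ - Real.exp (-(b t))) / 4) / t := by
      field_simp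
      ring
    linarith [hineq t htT]
  filter_upwards [eventually_lt_of_deriv_le (by linarith) (by norm_num) hderiv hbound
    (half_pos hε)] with t ht
  have := mul_pos hC (Real.exp_pos (-(b t)))
  linarith
end
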